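/- arXiv:1311.7507 — 5 statements merged into one kernel-verified Lean document; each statement's English description precedes it below -/
import Mathlib

section
/- Let D be a division ring whose center is the field F, with D finite-dimensional over F. Then there exist nonzero elements x, y ∈ D such that the subfield F(xyx⁻¹y⁻¹) generated over F by the multiplicative commutator xyx⁻¹y⁻¹ is a maximal subfield of D, i.e., it is maximal with respect to inclusion among subfields of D containing F. -/
open TensorProduct

theorem aux_simple (F L D : Type*) [Field F] [Field L] [Algebra F L] [DivisionRing D] [Algebra F D]
    (hcenter : Set.range (algebraMap F D) = Set.center D) : IsSimpleRing (L ⊗[F] D) := by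
  classical
  let B := Module.Basis.ofVectorSpace F L
  let r := TensorProduct.equivFinsuppOfBasisLeft (N := D) B
  have hl : ∀ (d : D) (u : L ⊗[F] D) i, r ((1 ⊗ₜ d) * u) i = d * r u i := by
    intro d u i
    induction u using TensorProduct.induction_on with
    | zero => simp
    | tmul l e => simp [r]
    | add a b ha hb => rw [mul_add, map_add, map_add, Finsupp.add_apply, Finsupp.add_apply, ha, hb, mul_add]
  have hr : ∀ (d : D) (u : L ⊗[F] D) i, r (u * (1 ⊗ₜ d)) i = r u i * d := by
    intro d u i
    induction u using TensorProduct.induction_on with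
    | zero => simp
    | tmul l e => simp [r]
    | add a b ha hb => rw [add_mul, map_add, map_add, Finsupp.add_apply, Finsupp.add_apply, ha, hb, add_mul]
  refine ⟨⟨fun I => ?_⟩⟩
  by_cases hI : I = ⊥
  · exact Or.inl hI
  right
  have hex : ∃ n : ℕ, ∃ u ∈ I, u ≠ 0 ∧ (r u).support.card = n := by
    by_contra! h
    apply hI
    rw [eq_bot_iff]
    intro u hu
    rw [TwoSidedIdeal.mem_bot]
    by_contra h0
    exact h _ u hu h0 rfl
  obtain ⟨u, hu, hu0, hcard⟩ := Nat.find_spec hex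
  have hmin : ∀ w ∈ I, (r w).support.card < (r u).support.card → w = 0 := by
    intro w hw hlt
    by_contra h0
    exact Nat.find_min hex (hcard ▸ hlt) ⟨w, hw, h0, rfl⟩
  have hru : r u ≠ 0 := by simpa using hu0
  obtain ⟨i0, hi0⟩ := Finsupp.ne_iff.1 hru
  rw [Finsupp.zero_apply] at hi0
  set v := (1 ⊗ₜ (r u i0)⁻¹) * u with hv
  have hvI : v ∈ I := I.mul_mem_left _ _ hu
  have hv1 : r v i0 = 1 := by rw [hv, hl, inv_mul_cancel₀ hi0]
  have hvs : (r v).support ⊆ (r u).support := by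
    intro i hi
    rw [Finsupp.mem_support_iff] at hi ⊢
    intro h
    apply hi
    rw [hv, hl, h, mul_zero]
  have hcen : ∀ i, r v i ∈ Set.center D := by
    intro i
    rw [Semigroup.mem_center_iff]
    intro d
    have hw : (1 ⊗ₜ d) * v - v * (1 ⊗ₜ d) = 0 := by
      apply hmin _ (I.sub_mem (I.mul_mem_left _ _ hvI) (I.mul_mem_right _ _ hvI))
      apply Finset.card_lt_card
      refine ⟨fun j hj => ?_, fun h => ?_⟩
      · rw [Finsupp.mem_support_iff, map_sub, Finsupp.sub_apply, hl, hr] at hj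
        apply hvs
        rw [Finsupp.mem_support_iff]
        intro h
        apply hj
        rw [h]; simp
      · have := h (Finsupp.mem_support_iff.2 hi0)
        rw [Finsupp.mem_support_iff, map_sub, Finsupp.sub_apply, hl, hr, hv1] at this
        simp at this
    have := congrArg (fun z => r z i) hw
    simp only [map_sub, Finsupp.sub_apply, hl, hr, map_zero, Finsupp.zero_apply] at this
    exact sub_eq_zero.1 this
  rw [← hcenter] at hcen
  choose f hf using hcen
  have hvv : v = (∑ i ∈ (r v).support, f i • B i) ⊗ₜ[F] (1 : D) := by
    apply r.injective
    conv_lhs => rw [← r.apply_symm_apply (r v)]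
    congr 1
    rw [TensorProduct.equivFinsuppOfBasisLeft_symm_apply, TensorProduct.sum_tmul, Finsupp.sum]
    refine Finset.sum_congr rfl fun i _ => ?_
    rw [← hf i, TensorProduct.smul_tmul, Algebra.algebraMap_eq_smul_one]
  set l := ∑ i ∈ (r v).support, f i • B i
  have hl0 : l ≠ 0 := by
    intro h
    rw [h, TensorProduct.zero_tmul] at hvv
    rw [hvv] at hv1
    simp at hv1
  have : (l⁻¹ ⊗ₜ[F] (1:D)) * v ∈ I := I.mul_mem_left _ _ hvI
  rw [hvv, Algebra.TensorProduct.tmul_mul_tmul, inv_mul_cancel₀ hl0, one_mul, ← Algebra.TensorProduct.one_def] at this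
  exact I.one_mem_iff.1 this

theorem aux_central {L : Type*} [Field L] {n : ℕ} (B C : Matrix (Fin n) (Fin n) L)
    (h : Commute B C) (v : Fin n → L)
    (hd : (Matrix.of fun i j : Fin n => ((C ^ (j : ℕ)).mulVec v) i).det ≠ 0) :
    ∃ a : Fin n → L, B = ∑ j, a j • C ^ (j : ℕ) := by
  set V := (Matrix.of fun i j : Fin n => ((C ^ (j : ℕ)).mulVec v) i) with hV
  have hu : IsUnit V.det := isUnit_iff_ne_zero.2 hd
  refine ⟨V⁻¹.mulVec (B.mulVec v), ?_⟩
  set a := V⁻¹.mulVec (B.mulVec v) with ha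
  have hVa : V.mulVec a = B.mulVec v := by
    rw [ha, Matrix.mulVec_mulVec, Matrix.mul_nonsing_inv _ hu, Matrix.one_mulVec]
  set N := ∑ j, a j • C ^ (j : ℕ) with hN
  have hNv : N.mulVec v = B.mulVec v := by
    rw [← hVa, hN, Matrix.sum_mulVec]
    ext i
    have : ∀ j : Fin n, (a j • C ^ (j : ℕ)).mulVec v = a j • (C ^ (j : ℕ)).mulVec v :=
      fun j => Matrix.smul_mulVec _ _ _
    simp only [this, Finset.sum_apply, Pi.smul_apply, smul_eq_mul]
    simp only [hV]
    change _ = ∑ j : Fin n, (C ^ (j : ℕ)).mulVec v i * a j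
    exact Finset.sum_congr rfl fun j _ => mul_comm _ _
  have hNC : Commute N C := by
    apply Commute.sum_left
    intro j _
    exact ((Commute.refl C).pow_left _).smul_left _
  have h0 : (B - N) * V = 0 := by
    ext i j
    have e : ((B - N) * V) i j = ((B - N).mulVec ((C ^ (j:ℕ)).mulVec v)) i := by
      simp [Matrix.mul_apply, Matrix.mulVec, dotProduct, hV]
    rw [e, Matrix.mulVec_mulVec, ((h.sub_left hNC).pow_right j).eq, ← Matrix.mulVec_mulVec,
      Matrix.sub_mulVec, hNv]
    simp
  have : (B - N) * V * V⁻¹ = 0 := by rw [h0, zero_mul]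
  rw [mul_assoc, Matrix.mul_nonsing_inv _ hu, mul_one] at this
  exact sub_eq_zero.1 this

theorem aux_exists_e (L : Type*) [Field L] [IsAlgClosed L] (n : ℕ) [NeZero n] :
    ∃ e : Fin n → L, Function.Injective e ∧ (∀ i, e i ≠ 0) ∧ ∏ i, e i = 1 := by
  have : Infinite L := IsAlgClosed.instInfinite
  have : Infinite Lˣ := by
    rw [unitsEquivNeZero.infinite_iff]
    exact (Set.finite_singleton (0 : L)).infinite_compl.to_subtype
  let g : Fin n ↪ Lˣ := (Fin.valEmbedding).trans (Infinite.natEmbedding Lˣ)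
  obtain ⟨z, hz⟩ := IsAlgClosed.exists_pow_nat_eq (∏ i, (g i : L)) (NeZero.pos n)
  have hp : ∏ i, (g i : L) ≠ 0 := Finset.prod_ne_zero_iff.2 fun i _ => (g i).ne_zero
  have hz0 : z ≠ 0 := by
    rintro rfl
    rw [zero_pow (NeZero.ne n)] at hz
    exact hp hz.symm
  refine ⟨fun i => g i * z⁻¹, ?_, fun i => mul_ne_zero (g i).ne_zero (inv_ne_zero hz0), ?_⟩
  · intro i j hij
    have := mul_right_cancel₀ (inv_ne_zero hz0) hij
    exact g.injective (Units.ext this)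
  · rw [Finset.prod_mul_distrib, Finset.prod_const, Finset.card_univ, Fintype.card_fin, inv_pow, hz,
      mul_inv_cancel₀ hp]

/-- the polynomial test function -/
def auxP {R : Type*} [CommRing R] {n : ℕ} (X Y : Matrix (Fin n) (Fin n) R) : R :=
  X.det * Y.det * (Matrix.of fun i j : Fin n =>
    (((X * Y * X.adjugate * Y.adjugate) ^ (j : ℕ)).mulVec (fun _ => 1)) i).det

theorem auxP_map {R S : Type*} [CommRing R] [CommRing S] (f : R →+* S) {n : ℕ}
    (X Y : Matrix (Fin n) (Fin n) R) : f (auxP X Y) = auxP (f.mapMatrix X) (f.mapMatrix Y) := by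
  unfold auxP
  rw [map_mul, map_mul, RingHom.map_det, RingHom.map_det, RingHom.map_det,
    ← RingHom.map_adjugate, ← RingHom.map_adjugate, ← map_mul, ← map_mul, ← map_mul]
  congr 2
  ext i j
  change f ((((X * Y * X.adjugate * Y.adjugate) ^ (j : ℕ)).mulVec (fun _ => 1)) i) =
    ((f.mapMatrix (X * Y * X.adjugate * Y.adjugate) ^ (j : ℕ)).mulVec (fun _ => 1)) i
  rw [← map_pow]
  generalize (X * Y * X.adjugate * Y.adjugate) ^ (j : ℕ) = Z
  simp [Matrix.mulVec, dotProduct]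

theorem aux_exists_XY (L : Type*) [Field L] [IsAlgClosed L] (n : ℕ) [NeZero n] :
    ∃ X Y : Matrix (Fin n) (Fin n) L, auxP X Y ≠ 0 := by
  obtain ⟨e, einj, e0, e1⟩ := aux_exists_e L n
  obtain ⟨m, rfl⟩ : ∃ m, n = m + 1 := ⟨n - 1, by have := NeZero.pos n; omega⟩
  let d : Fin (m+1) → L := fun i => Fin.partialProd e i.castSucc
  have hd0 : ∀ i, d i ≠ 0 := by
    intro i
    simp only [d, Fin.partialProd]
    apply List.prod_ne_zero
    intro h
    have := List.mem_of_mem_take h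
    rw [List.mem_ofFn] at this
    obtain ⟨j, hj⟩ := this
    exact e0 j hj
  have hd : ∀ i, d (finRotate (m+1) i) = e i * d i := by
    intro i
    have h1 : Fin.partialProd e i.succ = e i * d i := by
      rw [Fin.partialProd_succ, mul_comm]
    rw [← h1]
    by_cases hi : i = Fin.last m
    · subst hi
      have : Fin.partialProd e (Fin.last (m+1)) = 1 := by
        rw [← e1, ← List.prod_ofFn, Fin.partialProd, List.take_of_length_le]
        simp
      rw [finRotate_last, Fin.succ_last, this]
      simp [d]
    · simp only [d]
      congr 1
      ext
      rw [Fin.val_castSucc, coe_finRotate_of_ne_last hi, Fin.val_succ]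
  let X : Matrix (Fin (m+1)) (Fin (m+1)) L := (finRotate (m+1)).permMatrix L
  let Y := Matrix.diagonal d
  have hX : X.det ≠ 0 := by
    rw [Matrix.det_permutation]
    rcases Int.units_eq_one_or (Equiv.Perm.sign (finRotate (m+1))) with h | h <;> simp [h]
  have hY : Y.det ≠ 0 := by
    rw [Matrix.det_diagonal]
    exact Finset.prod_ne_zero_iff.2 fun i _ => hd0 i
  have hXY : X * Y = Matrix.diagonal e * Y * X := by
    ext i j
    simp only [X, Y]
    rw [Matrix.diagonal_mul_diagonal, Matrix.diagonal_mul, Matrix.mul_diagonal, ← hd]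
    have hp : (finRotate (m+1)).permMatrix L i j = if finRotate (m+1) i = j then 1 else 0 := by
      simp only [Equiv.Perm.permMatrix, PEquiv.toMatrix_apply, Equiv.toPEquiv_apply,
        Option.mem_some_iff]
    rw [hp]
    split_ifs with h
    · rw [h, one_mul, mul_one]
    · rw [zero_mul, mul_zero]
  have hZ : X * Y * X.adjugate * Y.adjugate = Matrix.diagonal (fun i => (X.det * Y.det) * e i) := by
    rw [hXY, mul_assoc _ X, Matrix.mul_adjugate, Matrix.mul_smul, mul_one, Matrix.smul_mul, mul_assoc,
      Matrix.mul_adjugate, Matrix.mul_smul, mul_one, smul_smul, ← Matrix.diagonal_smul]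
    rfl
  refine ⟨X, Y, mul_ne_zero (mul_ne_zero hX hY) ?_⟩
  rw [hZ]
  have : (Matrix.of fun i j : Fin (m+1) => (((Matrix.diagonal (fun i => (X.det * Y.det) * e i)) ^ (j : ℕ)).mulVec (fun _ => (1:L))) i) = Matrix.vandermonde (fun i => (X.det * Y.det) * e i) := by
    ext i j
    change (((Matrix.diagonal (fun i => (X.det * Y.det) * e i)) ^ (j : ℕ)).mulVec
      (fun _ => (1:L))) i = _
    rw [Matrix.diagonal_pow, Matrix.mulVec_diagonal, Matrix.vandermonde_apply, mul_one]
    rfl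
  rw [this, Matrix.det_vandermonde_ne_zero_iff]
  intro i j h
  exact einj (mul_left_cancel₀ (mul_ne_zero hX hY) h)

theorem aux_density {F L D : Type*} [Field F] [Infinite F] [Field L] [IsAlgClosed L] [Algebra F L]
    [DivisionRing D] [Algebra F D] [FiniteDimensional F D] {n : ℕ} [NeZero n]
    (Ψ : L ⊗[F] D ≃ₐ[L] Matrix (Fin n) (Fin n) L) :
    ∃ x y : D, auxP (Ψ (1 ⊗ₜ x)) (Ψ (1 ⊗ₜ y)) ≠ 0 := by
  classical
  let b := Module.finBasis F D
  let bL := Algebra.TensorProduct.basis L b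
  let ι := Fin (Module.finrank F D)
  let G : (k : ι → ι ⊕ ι) → Matrix (Fin n) (Fin n) (MvPolynomial (ι ⊕ ι) L) := fun k =>
    ∑ i, (MvPolynomial.X (k i) : MvPolynomial (ι ⊕ ι) L) •
      (MvPolynomial.C : L →+* MvPolynomial (ι ⊕ ι) L).mapMatrix (Ψ (1 ⊗ₜ b i))
  let P := auxP (G Sum.inl) (G Sum.inr)
  have hG : ∀ (s : ι ⊕ ι → L) k, (MvPolynomial.eval s).mapMatrix (G k) =
      Ψ (∑ i, s (k i) • (1 ⊗ₜ b i)) := by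
    intro s k
    ext p q
    simp [G, Matrix.sum_apply]
  by_contra! hcon
  have hP : P = 0 := by
    apply MvPolynomial.funext_set (fun _ => Set.range (algebraMap F L))
      (fun _ => Set.infinite_range_of_injective (algebraMap F L).injective)
    intro s hs
    have hs' : ∀ i, ∃ t : F, algebraMap F L t = s i := fun i => hs i trivial
    choose t ht using hs'
    have key : ∀ k : ι → ι ⊕ ι, ∑ i, s (k i) • ((1:L) ⊗ₜ[F] b i) = 1 ⊗ₜ (∑ i, t (k i) • b i) := by
      intro k
      rw [TensorProduct.tmul_sum]
      refine Finset.sum_congr rfl fun i _ => ?_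
      rw [← ht, algebraMap_smul, TensorProduct.tmul_smul]
    rw [auxP_map, hG, hG, key, key, hcon, map_zero]
  obtain ⟨X, Y, hXY⟩ := aux_exists_XY L n
  apply hXY
  let s : ι ⊕ ι → L := Sum.elim (bL.repr (Ψ.symm X)) (bL.repr (Ψ.symm Y))
  have h := congrArg (MvPolynomial.eval s) hP
  rw [auxP_map, hG, hG, map_zero] at h
  have key : ∀ Z : Matrix (Fin n) (Fin n) L, Ψ (∑ i, bL.repr (Ψ.symm Z) i • (1 ⊗ₜ b i)) = Z := by
    intro Z
    have := bL.sum_repr (Ψ.symm Z)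
    simp only [bL, Algebra.TensorProduct.basis_apply] at this ⊢
    rw [this, AlgEquiv.apply_symm_apply]
  have hX := key X
  have hY := key Y
  simp only [s, Sum.elim_inl, Sum.elim_inr] at h
  exact (congrArg₂ auxP hX hY).symm.trans h

theorem aux_centralizer (F D : Type*) [Field F] [Infinite F] [DivisionRing D] [Algebra F D]
    (hcenter : Set.range (algebraMap F D) = Set.center D)
    [FiniteDimensional F D] :
    ∃ x y : D, x ≠ 0 ∧ y ≠ 0 ∧ ∀ b : D, Commute b (x * y * x⁻¹ * y⁻¹) →
      b ∈ Submodule.span F (Set.range fun j : ℕ => (x * y * x⁻¹ * y⁻¹) ^ j) := by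
  let L := AlgebraicClosure F
  have := aux_simple F L D hcenter
  obtain ⟨n, hn, ⟨Ψ⟩⟩ := IsSimpleRing.exists_algEquiv_matrix_of_isAlgClosed L (L ⊗[F] D)
  obtain ⟨x, y, hxy⟩ := aux_density Ψ
  let φ : D →ₐ[F] Matrix (Fin n) (Fin n) L :=
    (Ψ.restrictScalars F).toAlgHom.comp Algebra.TensorProduct.includeRight
  have hφ : ∀ d, Ψ (1 ⊗ₜ d) = φ d := fun d => rfl
  rw [hφ, hφ] at hxy
  have hdx : (φ x).det ≠ 0 := left_ne_zero_of_mul (left_ne_zero_of_mul hxy)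
  have hdy : (φ y).det ≠ 0 := right_ne_zero_of_mul (left_ne_zero_of_mul hxy)
  have h3 := right_ne_zero_of_mul hxy
  have hne : Nonempty (Fin n) := ⟨0⟩
  have hx : x ≠ 0 := by
    rintro rfl
    rw [map_zero, Matrix.det_zero] at hdx
    exact hdx rfl
  have hy : y ≠ 0 := by
    rintro rfl
    rw [map_zero, Matrix.det_zero] at hdy
    exact hdy rfl
  refine ⟨x, y, hx, hy, fun b hb => ?_⟩
  set c := x * y * x⁻¹ * y⁻¹ with hc
  have hadj : ∀ z : D, z ≠ 0 → (φ z).adjugate = (φ z).det • φ z⁻¹ := by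
    intro z hz
    have h1 : φ z⁻¹ * φ z = 1 := by rw [← map_mul, inv_mul_cancel₀ hz, map_one]
    calc (φ z).adjugate = φ z⁻¹ * φ z * (φ z).adjugate := by rw [h1, one_mul]
      _ = _ := by rw [mul_assoc, Matrix.mul_adjugate, Matrix.mul_smul, mul_one]
  have hZ : φ x * φ y * (φ x).adjugate * (φ y).adjugate = ((φ y).det * (φ x).det) • φ c := by
    rw [hadj x hx, hadj y hy, Matrix.mul_smul, Matrix.mul_smul, Matrix.smul_mul, smul_smul, hc]
    simp only [map_mul]
  rw [hZ] at h3
  obtain ⟨a, ha⟩ := aux_central (φ b) _ ((hb.map φ).smul_right _) _ h3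
  by_contra hnot
  obtain ⟨f, hfb, hf⟩ := Submodule.exists_le_ker_of_notMem hnot
  let g : L ⊗[F] D →ₗ[L] L := (TensorProduct.AlgebraTensorModule.rid F L L).toLinearMap ∘ₗ f.baseChange L
  have hg : ∀ d : D, g (1 ⊗ₜ d) = algebraMap F L (f d) := by
    intro d
    simp [g, Algebra.algebraMap_eq_smul_one]
  have hs : ∀ d : D, Ψ.symm (φ d) = 1 ⊗ₜ d := fun d => by rw [← hφ, AlgEquiv.symm_apply_apply]
  have h := congrArg (fun M => g (Ψ.symm M)) ha
  simp only [smul_pow, map_sum, map_smul, ← map_pow] at h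
  simp only [hs, hg] at h
  rw [Finset.sum_eq_zero] at h
  · apply hfb
    exact (algebraMap F L).injective (by rw [h, map_zero])
  · intro j _
    have : f (c ^ (j:ℕ)) = 0 := hf (Submodule.subset_span ⟨j, rfl⟩)
    rw [this]
    simp

theorem maximal_subfield_of_multiplicative_commutator
    (F D : Type*) [Field F] [DivisionRing D] [Algebra F D]
    (hcenter : Set.range (algebraMap F D) = Set.center D)
    [FiniteDimensional F D] :
    ∃ x y : D, x ≠ 0 ∧ y ≠ 0 ∧
      Maximal (fun K : Subfield D => Set.range (algebraMap F D) ⊆ (K : Set D) ∧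
          ∀ a ∈ K, ∀ b ∈ K, a * b = b * a)
        (Subfield.closure (Set.range (algebraMap F D) ∪ {x * y * x⁻¹ * y⁻¹})) := by
  have main : ∃ x y : D, x ≠ 0 ∧ y ≠ 0 ∧ ∀ b : D, Commute b (x * y * x⁻¹ * y⁻¹) →
      b ∈ Submodule.span F (Set.range fun j : ℕ => (x * y * x⁻¹ * y⁻¹) ^ j) := by
    rcases finite_or_infinite F with hF | hF
    · have : Finite D := Module.finite_of_finite F
      have hcomm : ∀ a b : D, a * b = b * a := (littleWedderburn D).mul_comm
      refine ⟨1, 1, one_ne_zero, one_ne_zero, fun b _ => ?_⟩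
      have hb : b ∈ Set.range (algebraMap F D) := by
        rw [hcenter, Semigroup.mem_center_iff]
        exact fun g => hcomm g b
      obtain ⟨t, rfl⟩ := hb
      rw [Algebra.algebraMap_eq_smul_one]
      exact Submodule.smul_mem _ _ (Submodule.subset_span ⟨0, by simp⟩)
    · exact aux_centralizer F D hcenter
  obtain ⟨x, y, hx, hy, h⟩ := main
  refine ⟨x, y, hx, hy, ?_⟩
  set c := x * y * x⁻¹ * y⁻¹
  set K := Subfield.closure (Set.range (algebraMap F D) ∪ {c}) with hK
  have hFK : Set.range (algebraMap F D) ⊆ (K : Set D) :=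
    fun z hz => Subfield.subset_closure (Or.inl hz)
  have hcK : c ∈ K := Subfield.subset_closure (Or.inr rfl)
  have hspan : ∀ b ∈ Submodule.span F (Set.range fun j : ℕ => c ^ j), b ∈ K := by
    intro b hb
    induction hb using Submodule.span_induction with
    | mem z hz => obtain ⟨j, rfl⟩ := hz; exact pow_mem hcK j
    | zero => exact zero_mem _
    | add a b _ _ ha hb => exact add_mem ha hb
    | smul t a _ ha => rw [Algebra.smul_def]; exact mul_mem (hFK ⟨t, rfl⟩) ha
  have hKc : ∀ b ∈ K, Commute b c := by
    intro b hb
    induction hb using Subfield.closure_induction with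
    | mem z hz =>
      rcases hz with ⟨t, rfl⟩ | rfl
      · exact Algebra.commutes t c
      · exact Commute.refl _
    | one => exact Commute.one_left _
    | add a b _ _ ha hb => exact ha.add_left hb
    | neg a _ ha => exact ha.neg_left
    | inv a _ ha => exact ha.inv_left₀
    | mul a b _ _ ha hb => exact ha.mul_left hb
  have hKcomm : ∀ a ∈ K, ∀ b ∈ K, a * b = b * a := by
    intro a ha b hb
    have hb' := h b (hKc b hb)
    have hac := hKc a ha
    change Commute a b
    clear hb
    induction hb' using Submodule.span_induction with
    | mem z hz => obtain ⟨j, rfl⟩ := hz; exact hac.pow_right j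
    | zero => exact Commute.zero_right _
    | add p q _ _ hp hq => exact hp.add_right hq
    | smul t p _ hp => exact hp.smul_right t
  refine ⟨⟨hFK, hKcomm⟩, fun K' hK' hle b hb => ?_⟩
  exact hspan b (h b (hK'.2 b hb c (hle hcK)))
end

section
/- Let D be a division ring whose center is the field F, with dim_F D = n² finite (so D has degree n over F). Then there exist nonzero elements x, y ∈ D such that the subfield F(xyx⁻¹y⁻¹) satisfies dim_F F(xyx⁻¹y⁻¹) = n; that is, the maximum over all nonzero x, y ∈ D of dim_F F(xyx⁻¹y⁻¹) equals n. -/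
open TensorProduct

theorem simple_tensor_aux (F K D : Type*) [Field F] [Field K] [Algebra F K] [DivisionRing D] [Algebra F D]
    (hcenter : Set.range (algebraMap F D) = Set.center D) : IsSimpleRing (K ⊗[F] D) := by
  classical
  let ℬ := Module.Basis.ofVectorSpace F K
  let f : K ⊗[F] D ≃ₗ[F] _ →₀ D := TensorProduct.equivFinsuppOfBasisLeft (N := D) ℬ
  have hl : ∀ (d : D) (x : K ⊗[F] D) i, f ((1 ⊗ₜ d) * x) i = d * f x i := by
    intro d x i
    induction x with
    | zero => simp
    | tmul a b => simp [f]
    | add x y hx hy => simp [mul_add, hx, hy]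
  have hr : ∀ (d : D) (x : K ⊗[F] D) i, f (x * (1 ⊗ₜ d)) i = f x i * d := by
    intro d x i
    induction x with
    | zero => simp
    | tmul a b => simp [f]
    | add x y hx hy => simp [add_mul, hx, hy]
  have : Nontrivial (K ⊗[F] D) := inferInstance
  refine IsSimpleRing.of_eq_bot_or_eq_top fun I => ?_
  by_cases hI : I = ⊥
  · exact Or.inl hI
  right
  have hex : ∃ m : ℕ, ∃ x ∈ I, x ≠ 0 ∧ (f x).support.card = m := by
    by_contra! h
    apply hI
    rw [eq_bot_iff]
    intro x hx
    by_contra hx0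
    exact h _ x hx (by simpa [TwoSidedIdeal.mem_bot] using hx0) rfl
  obtain ⟨x, hxI, hx0, hxm⟩ := Nat.find_spec hex
  have hmin : ∀ y ∈ I, (f y).support.card < (f x).support.card → y = 0 := by
    intro y hy hlt
    by_contra hy0
    exact Nat.find_min hex (hxm ▸ hlt) ⟨y, hy, hy0, rfl⟩
  have hfx : f x ≠ 0 := by simpa using hx0
  obtain ⟨i0, hi0⟩ := Finsupp.ne_iff.mp hfx
  simp only [Finsupp.coe_zero, Pi.zero_apply] at hi0
  let z : K ⊗[F] D := (1 ⊗ₜ (f x i0)⁻¹) * x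
  have hz : ∀ i, f z i = (f x i0)⁻¹ * f x i := fun i => hl _ _ _
  have hzI : z ∈ I := I.mul_mem_left _ _ hxI
  have hcomm : ∀ d : D, (1 ⊗ₜ d) * z - z * (1 ⊗ₜ d) = 0 := by
    intro d
    apply hmin _ (I.sub_mem (I.mul_mem_left _ _ hzI) (I.mul_mem_right _ _ hzI))
    apply Finset.card_lt_card
    rw [Finset.ssubset_iff_of_subset]
    · refine ⟨i0, by simpa using hi0, ?_⟩
      simp [hl, hr, hz, hi0]
    · intro i hi
      simp only [Finsupp.mem_support_iff] at hi ⊢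
      contrapose! hi
      simp [hl, hr, hz, hi]
  have hcen : ∀ i, ∃ c : F, algebraMap F D c = f z i := by
    intro i
    have : f z i ∈ Set.center D := by
      rw [Semigroup.mem_center_iff]
      intro d
      have := congrArg (fun t => f t i) (hcomm d)
      simp only [map_sub, Finsupp.sub_apply, hl, hr, map_zero, Finsupp.zero_apply] at this
      exact sub_eq_zero.mp this
    rw [← hcenter] at this
    exact this
  choose c hc using hcen
  have hzk : ∃ k : K, z = k ⊗ₜ 1 := by
    refine ⟨∑ i ∈ (f z).support, c i • ℬ i, ?_⟩
    have h1 : z = f.symm (f z) := by simp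
    refine h1.trans ?_
    simp only [f, TensorProduct.equivFinsuppOfBasisLeft_symm_apply]
    rw [TensorProduct.sum_tmul]
    rw [Finsupp.sum]
    refine Finset.sum_congr rfl fun i _ => ?_
    rw [TensorProduct.smul_tmul, ← Algebra.algebraMap_eq_smul_one, hc i]
  obtain ⟨k, hk⟩ := hzk
  have hk0 : k ≠ 0 := by
    rintro rfl
    have := hz i0
    rw [hk] at this
    simp [hi0] at this
  have h1 : (1 : K ⊗[F] D) ∈ I := by
    have := I.mul_mem_left (k⁻¹ ⊗ₜ 1) _ hzI
    rw [hk] at this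
    simpa [hk0, Algebra.TensorProduct.one_def] using this
  rw [eq_top_iff]
  intro y _
  simpa using I.mul_mem_left y _ h1

theorem split_aux (F D : Type*) [Field F] [DivisionRing D] [Algebra F D]
    (hcenter : Set.range (algebraMap F D) = Set.center D)
    [FiniteDimensional F D] (n : ℕ) (hn : Module.finrank F D = n ^ 2) :
    ∃ _φ : (AlgebraicClosure F) ⊗[F] D ≃ₐ[AlgebraicClosure F]
      Matrix (Fin n) (Fin n) (AlgebraicClosure F), True := by
  have := simple_tensor_aux F (AlgebraicClosure F) D hcenter
  obtain ⟨m, _, ⟨e⟩⟩ := IsSimpleRing.exists_algEquiv_matrix_of_isAlgClosed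
    (AlgebraicClosure F) ((AlgebraicClosure F) ⊗[F] D)
  have h := e.toLinearEquiv.finrank_eq
  rw [Module.finrank_baseChange, hn, Module.finrank_matrix] at h
  simp at h
  have : m = n := by
    apply Nat.pow_left_injective (n := 2) (by norm_num)
    simp only; rw [h]; ring
  subst this
  exact ⟨e, trivial⟩

theorem upper_aux (F D : Type*) [Field F] [DivisionRing D] [Algebra F D]
    [FiniteDimensional F D] (n : ℕ) 
    (φ : (AlgebraicClosure F) ⊗[F] D ≃ₐ[AlgebraicClosure F]
      Matrix (Fin n) (Fin n) (AlgebraicClosure F)) (c : D) :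
    Module.finrank F (Algebra.adjoin F {c} : Subalgebra F D) ≤ n := by
  classical
  have hint : IsIntegral F c := Algebra.IsIntegral.isIntegral c
  have hspan := Submodule.span_range_natDegree_eq_adjoin (minpoly.monic hint) (minpoly.aeval F c)
  have h1 : Module.finrank F (Algebra.adjoin F {c} : Subalgebra F D) ≤ (minpoly F c).natDegree := by
    change Module.finrank F (Subalgebra.toSubmodule (Algebra.adjoin F {c})) ≤ _
    rw [← hspan]
    refine (finrank_span_finset_le_card _).trans ?_
    exact Finset.card_image_le.trans (by simp)
  refine h1.trans ?_
  by_contra! hlt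
  have hli : LinearIndependent F (fun i : Fin (n+1) => c ^ (i : ℕ)) :=
    (linearIndependent_pow (K := F) c).comp (Fin.castLE hlt) (Fin.castLE_injective _)
  have hli2 : LinearIndependent (AlgebraicClosure F)
      (fun i : Fin (n+1) => (1 : AlgebraicClosure F) ⊗ₜ[F] (c ^ (i : ℕ))) := by
    let b := Module.Basis.extend hli.linearIndepOn_id
    have h := (b.baseChange (AlgebraicClosure F)).linearIndependent
    have h2 := h.comp (fun i : Fin (n+1) => ⟨c ^ (i : ℕ), Module.Basis.subset_extend _ ⟨i, rfl⟩⟩) (by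
      intro i j hij
      exact hli.injective (congrArg Subtype.val hij))
    convert h2 using 2 with i
    simp [b]
  have hli3 := hli2.map' φ.toLinearMap (LinearMap.ker_eq_bot.mpr φ.injective)
  set M := φ (1 ⊗ₜ c)
  have hch := Matrix.aeval_self_charpoly M
  rw [Polynomial.aeval_eq_sum_range, Matrix.charpoly_natDegree_eq_dim, Fintype.card_fin,
    Finset.sum_range] at hch
  rw [Fintype.linearIndependent_iff] at hli3
  have := hli3 (fun i => M.charpoly.coeff i) (by
    rw [← hch]
    refine Finset.sum_congr rfl fun i _ => ?_
    have : (1 : AlgebraicClosure F) ⊗ₜ[F] (c ^ (i : ℕ)) = (1 ⊗ₜ c) ^ (i : ℕ) := by simp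
    simp only [Function.comp_apply, this, AlgEquiv.toLinearMap_apply, map_pow]
    rfl) (Fin.last n)
  have hm := Matrix.charpoly_monic M
  rw [Polynomial.Monic, Polynomial.leadingCoeff, Matrix.charpoly_natDegree_eq_dim, Fintype.card_fin] at hm
  simp [hm] at this


/-- Inverse-free version of the commutator. -/
noncomputable def cmAux {R : Type*} [CommRing R] {n : ℕ} (X Y : Matrix (Fin n) (Fin n) R) :
    Matrix (Fin n) (Fin n) R := X * Y * X.adjugate * Y.adjugate

/-- Krylov matrix of the all-ones vector. -/
noncomputable def kryAux {R : Type*} [CommRing R] {n : ℕ} (C : Matrix (Fin n) (Fin n) R) :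
    Matrix (Fin n) (Fin n) R := Matrix.of fun i j => ((C ^ (j : ℕ)).mulVec 1) i

theorem cmAux_mul {R : Type*} [CommRing R] {n : ℕ} (X Y : Matrix (Fin n) (Fin n) R) :
    cmAux X Y * (Y * X) = (X.det * Y.det) • (X * Y) := by
  have : cmAux X Y * (Y * X) = X * Y * (X.adjugate * (Y.adjugate * Y) * X) := by
    simp only [cmAux, Matrix.mul_assoc]
  rw [this, Matrix.adjugate_mul, Matrix.mul_smul, Matrix.mul_one, Matrix.smul_mul,
    Matrix.adjugate_mul, smul_smul, Matrix.mul_smul, Matrix.mul_one, mul_comm]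

theorem cmAux_eq {K : Type*} [Field K] {n : ℕ} (X Y c : Matrix (Fin n) (Fin n) K)
    (hX : X.det ≠ 0) (hY : Y.det ≠ 0) (h : c * (Y * X) = X * Y) :
    cmAux X Y = (X.det * Y.det) • c := by
  have hu : IsUnit (Y * X) := by
    rw [Matrix.isUnit_iff_isUnit_det, Matrix.det_mul]
    exact (mul_ne_zero hY hX).isUnit
  apply hu.mul_right_cancel
  rw [cmAux_mul, Matrix.smul_mul, h]

theorem cmAux_map {R S : Type*} [CommRing R] [CommRing S] (f : R →+* S) {n : ℕ}
    (X Y : Matrix (Fin n) (Fin n) R) :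
    (cmAux X Y).map f = cmAux (X.map f) (Y.map f) := by
  have := fun Z : Matrix (Fin n) (Fin n) R => RingHom.map_adjugate f Z
  simp only [RingHom.mapMatrix_apply] at this
  simp [cmAux, Matrix.map_mul, this]

theorem kryAux_map {R S : Type*} [CommRing R] [CommRing S] (f : R →+* S) {n : ℕ}
    (X : Matrix (Fin n) (Fin n) R) :
    (kryAux X).map f = kryAux (X.map f) := by
  ext i j
  have : (X.map f) ^ (j : ℕ) = (X ^ (j : ℕ)).map f := by
    simpa using (map_pow f.mapMatrix X j).symm
  simp [kryAux, this, Matrix.mulVec, dotProduct]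

theorem exists_t_aux (K : Type*) [Field K] [Infinite K] (N : ℕ) :
    ∃ t : K, t ≠ 0 ∧ ∀ p q : ℕ, p ≤ N → q ≤ N → t ^ p = t ^ q → p = q := by
  classical
  let P : Polynomial K := Polynomial.X * ∏ m ∈ Finset.Icc 1 N, (Polynomial.X ^ m - 1)
  have hP : P ≠ 0 := by
    refine mul_ne_zero Polynomial.X_ne_zero (Finset.prod_ne_zero_iff.mpr fun m hm => ?_)
    have := (Finset.mem_Icc.mp hm).1
    exact Polynomial.X_pow_sub_C_ne_zero (by omega) 1
  obtain ⟨t, ht⟩ := Infinite.exists_notMem_finset P.roots.toFinset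
  have ht' : P.eval t ≠ 0 := by simpa [hP] using ht
  simp only [P, Polynomial.eval_mul, Polynomial.eval_X, Polynomial.eval_prod, mul_ne_zero_iff,
    Finset.prod_ne_zero_iff] at ht'
  refine ⟨t, ht'.1, ?_⟩
  have key : ∀ p q : ℕ, p < q → q ≤ N → t ^ p ≠ t ^ q := by
    intro p q hpq hq h
    apply ht'.2 (q - p) (by simp; omega)
    have : t ^ q = t ^ p * t ^ (q - p) := by rw [← pow_add]; congr 1; omega
    rw [this] at h
    have h1 := (mul_eq_left₀ (pow_ne_zero p ht'.1)).mp h.symm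
    simp [h1]
  intro p q hp hq h
  rcases lt_trichotomy p q with h1 | h1 | h1
  · exact absurd h (key p q h1 hq)
  · exact h1
  · exact absurd h.symm (key q p h1 hp)

theorem exists_pt_aux (K : Type*) [Field K] [Infinite K] (k : ℕ) :
    ∃ A B : Matrix (Fin (k+1)) (Fin (k+1)) K, (kryAux (cmAux A B)).det ≠ 0 := by
  classical
  obtain ⟨t, ht0, ht⟩ := exists_t_aux K (2 * (k+1)^2)
  let σ := finRotate (k+1)
  let a : Fin (k+1) → K := fun i => t ^ ((i : ℕ)^2)
  have ha : ∀ i, a i ≠ 0 := fun i => pow_ne_zero _ ht0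
  let d : Fin (k+1) → K := fun i => a i / a (σ i)
  have hd : Function.Injective d := by
    intro i j hij
    simp only [d] at hij
    rw [div_eq_div_iff (ha _) (ha _)] at hij
    simp only [a, ← pow_add] at hij
    have hb : ∀ i : Fin (k+1), (i : ℕ)^2 ≤ (k+1)^2 := fun i =>
      Nat.pow_le_pow_left (by omega) 2
    have := ht _ _ (by linarith [hb i, hb (σ j)]) (by linarith [hb j, hb (σ i)]) hij
    have hσ : ∀ i : Fin (k+1), ((i : ℕ) = k ∧ ((σ i : Fin (k+1)) : ℕ) = 0) ∨
        ((i : ℕ) < k ∧ ((σ i : Fin (k+1)) : ℕ) = i + 1) := by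
      intro i
      by_cases h : i = Fin.last k
      · left; subst h; simp [σ]
      · right
        have h2 : (i : ℕ) < k := Fin.val_lt_last h
        refine ⟨h2, ?_⟩
        exact coe_finRotate_of_ne_last h
    apply Fin.ext
    rcases hσ i with ⟨h1, h2⟩ | ⟨h1, h2⟩ <;> rcases hσ j with ⟨h3, h4⟩ | ⟨h3, h4⟩
    · omega
    · rw [h2, h4] at this; nlinarith
    · rw [h2, h4] at this; nlinarith
    · rw [h2, h4] at this; nlinarith
  let B : Matrix (Fin (k+1)) (Fin (k+1)) K := σ.permMatrix K
  have hA : (Matrix.diagonal a).det ≠ 0 := by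
    rw [Matrix.det_diagonal]; exact Finset.prod_ne_zero_iff.mpr fun i _ => ha i
  have hB : B.det ≠ 0 := by
    rw [Matrix.det_permutation]
    rcases Int.units_eq_one_or (Equiv.Perm.sign σ) with h | h <;> simp [h]
  refine ⟨Matrix.diagonal a, B, ?_⟩
  rw [cmAux_eq (Matrix.diagonal a) B (Matrix.diagonal d) hA hB]
  · set δ := (Matrix.diagonal a).det * B.det with hδ
    have hδ0 : δ ≠ 0 := mul_ne_zero hA hB
    have : kryAux (δ • Matrix.diagonal d) = Matrix.vandermonde (fun i => δ * d i) := by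
      ext i j
      simp [kryAux, smul_pow, Matrix.diagonal_pow, Matrix.mulVec_diagonal, Matrix.smul_mulVec,
        Matrix.vandermonde, mul_pow]
    rw [this, Matrix.det_vandermonde_ne_zero_iff]
    intro i j hij
    exact hd (mul_left_cancel₀ hδ0 hij)
  · ext i j
    rw [Matrix.diagonal_mul, Matrix.mul_diagonal, Matrix.diagonal_mul]
    simp only [B, Equiv.Perm.permMatrix, PEquiv.toMatrix_apply, Equiv.toPEquiv_apply,
      Option.mem_def, Option.some.injEq]
    split_ifs with h
    · subst h; simp [d, div_mul_cancel₀ _ (ha _)]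
    · simp

theorem li_aux {F D K : Type*} [Field F] [Field K] [DivisionRing D] [Algebra F D] [Algebra F K]
    {n : ℕ} (hn : 2 ≤ n) (ψ : D →ₐ[F] Matrix (Fin n) (Fin n) K) (x y : D)
    (h : (kryAux (cmAux (ψ x) (ψ y))).det ≠ 0) :
    x ≠ 0 ∧ y ≠ 0 ∧ LinearIndependent F (fun i : Fin n => (x * y * x⁻¹ * y⁻¹) ^ (i : ℕ)) := by
  have hz : (kryAux (0 : Matrix (Fin n) (Fin n) K)).det = 0 := by
    apply Matrix.det_eq_zero_of_column_eq_zero ⟨1, hn⟩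
    intro i
    simp [kryAux]
  have hx : x ≠ 0 := by
    rintro rfl
    exact h (by simpa [cmAux] using hz)
  have hy : y ≠ 0 := by
    rintro rfl
    exact h (by simpa [cmAux] using hz)
  refine ⟨hx, hy, ?_⟩
  have hdet : ∀ z : D, z ≠ 0 → (ψ z).det ≠ 0 := by
    intro z hz
    exact ((Matrix.isUnit_iff_isUnit_det _).mp (hz.isUnit.map ψ)).ne_zero
  set c := x * y * x⁻¹ * y⁻¹ with hc
  have hcyx : c * (y * x) = x * y := by
    simp [hc, mul_assoc, hx, hy]
  rw [cmAux_eq (ψ x) (ψ y) (ψ c) (hdet x hx) (hdet y hy)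
    (by rw [← map_mul, ← map_mul, hcyx, map_mul])] at h
  set δ := (ψ x).det * (ψ y).det with hδ
  have hδ0 : δ ≠ 0 := mul_ne_zero (hdet x hx) (hdet y hy)
  rw [Fintype.linearIndependent_iff]
  intro g hg
  have h1 : ∑ i : Fin n, (algebraMap F K (g i)) • (ψ c) ^ (i : ℕ) = 0 := by
    have := congrArg ψ hg
    simpa [map_sum] using this
  have h2 := Matrix.eq_zero_of_mulVec_eq_zero h
    (v := fun i => algebraMap F K (g i) * (δ⁻¹) ^ (i : ℕ)) (by
      have h3 := congrArg (fun M => M.mulVec 1) h1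
      simp only [Matrix.sum_mulVec, Matrix.zero_mulVec] at h3
      rw [← h3]
      ext i
      simp only [Matrix.mulVec, dotProduct, kryAux, Matrix.of_apply, Finset.sum_apply]
      refine Finset.sum_congr rfl fun j _ => ?_
      simp only [smul_pow, Matrix.smul_apply, smul_eq_mul, Pi.one_apply, mul_one,
        ← Finset.mul_sum]
      have : δ ^ (j : ℕ) * δ⁻¹ ^ (j : ℕ) = 1 := by rw [← mul_pow, mul_inv_cancel₀ hδ0, one_pow]
      linear_combination (∑ i_1, (ψ c ^ (j : ℕ)) i i_1) * algebraMap F K (g j) * this)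
  intro i
  have := congrFun h2 i
  simpa [hδ0] using this

theorem exists_aux {F D K : Type*} [Field F] [Infinite F] [Field K] [DivisionRing D] [Algebra F D]
    [Algebra F K] [FiniteDimensional F D]
    {n : ℕ} (hn : 2 ≤ n) (φ : K ⊗[F] D ≃ₐ[K] Matrix (Fin n) (Fin n) K) :
    ∃ x y : D, x ≠ 0 ∧ y ≠ 0 ∧
      LinearIndependent F (fun i : Fin n => (x * y * x⁻¹ * y⁻¹) ^ (i : ℕ)) := by
  classical
  let ψ : D →ₐ[F] Matrix (Fin n) (Fin n) K :=
    (φ.toAlgHom.restrictScalars F).comp Algebra.TensorProduct.includeRight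
  have hinj : Function.Injective (algebraMap F K) := (algebraMap F K).injective
  have : Infinite K := Infinite.of_injective _ hinj
  let b := Module.finBasis F D
  let E := (b.baseChange K).map φ.toLinearEquiv
  have hE : ∀ i, E i = ψ (b i) := by intro i; simp [E, ψ]
  let ι := Fin (Module.finrank F D)
  let gen : Fin 2 → Matrix (Fin n) (Fin n) (MvPolynomial (Fin 2 × ι) K) := fun s =>
    ∑ i : ι, (MvPolynomial.X (s, i) : MvPolynomial (Fin 2 × ι) K) • (E i).map MvPolynomial.C
  have hgen : ∀ (s : Fin 2) (p : Fin 2 × ι → K),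
      (gen s).map (MvPolynomial.eval p) = ∑ i : ι, p (s, i) • E i := by
    intro s p
    ext u v
    simp [gen, Matrix.sum_apply]
  let P := (kryAux (cmAux (gen 0) (gen 1))).det
  have hP : ∀ p, MvPolynomial.eval p P =
      (kryAux (cmAux (∑ i : ι, p (0, i) • E i) (∑ i : ι, p (1, i) • E i))).det := by
    intro p
    simp only [P]
    rw [RingHom.map_det, RingHom.mapMatrix_apply, kryAux_map, cmAux_map, hgen, hgen]
  have hP0 : P ≠ 0 := by
    obtain ⟨k, rfl⟩ : ∃ k, n = k + 1 := ⟨n - 1, by omega⟩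
    obtain ⟨A, B, hAB⟩ := exists_pt_aux K k
    intro h0
    have := hP (fun s => if s.1 = 0 then E.repr A s.2 else E.repr B s.2)
    simp only [h0, map_zero, if_true, one_ne_zero, if_false] at this
    rw [show ∑ x : ι, E.repr A x • E x = A from E.sum_repr A,
      show ∑ x : ι, E.repr B x • E x = B from E.sum_repr B] at this
    exact hAB this.symm
  have hex : ∃ p ∈ Set.pi Set.univ (fun _ : Fin 2 × ι => Set.range (algebraMap F K)),
      MvPolynomial.eval p P ≠ 0 := by
    by_contra! h
    apply hP0
    apply MvPolynomial.funext_set (fun _ : Fin 2 × ι => Set.range (algebraMap F K))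
      (fun _ => Set.infinite_range_of_injective hinj)
    intro p hp
    rw [h p hp, map_zero]
  obtain ⟨p, hp, hpP⟩ := hex
  choose q hq using fun s => hp s trivial
  rw [hP] at hpP
  have hs : ∀ s : Fin 2, ∑ i : ι, p (s, i) • E i = ψ (∑ i : ι, q (s, i) • b i) := by
    intro s
    simp only [map_sum, map_smul, hE, ← hq, algebraMap_smul]
  rw [hs, hs] at hpP
  exact ⟨_, _, li_aux hn ψ _ _ hpP⟩

/-- **Theorem.** Let `D` be a division ring whose center is the field `F`, with
`dim_F D = n ^ 2` finite (so `D` has degree `n` over `F`). Then the maximum, over all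
nonzero `x y : D`, of `dim_F F(x * y * x⁻¹ * y⁻¹)` equals `n`; here
`F(x * y * x⁻¹ * y⁻¹)` is the `F`-subalgebra of `D` generated by the multiplicative
commutator `x * y * x⁻¹ * y⁻¹` (a subfield of `D`, since the commutator is algebraic
over `F`). -/
theorem finrank_adjoin_multiplicative_commutator_isGreatest
    (F D : Type*) [Field F] [DivisionRing D] [Algebra F D]
    (hcenter : Set.range (algebraMap F D) = Set.center D)
    [FiniteDimensional F D] (n : ℕ) (hn : Module.finrank F D = n ^ 2) :
    IsGreatest {d : ℕ | ∃ x y : D, x ≠ 0 ∧ y ≠ 0 ∧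
      Module.finrank F (Algebra.adjoin F {x * y * x⁻¹ * y⁻¹} : Subalgebra F D) = d} n := by
  obtain ⟨φ, -⟩ := split_aux F D hcenter n hn
  have hup := fun c => upper_aux F D n φ c
  refine ⟨?_, ?_⟩
  · have hn0 : n ≠ 0 := by
      rintro rfl
      have : 0 < Module.finrank F D := Module.finrank_pos
      omega
    by_cases hn1 : n = 1
    · subst hn1
      refine ⟨1, 1, one_ne_zero, one_ne_zero, le_antisymm (hup _) ?_⟩
      exact Module.finrank_pos
    · have hn2 : 2 ≤ n := by omega
      have hinf : Infinite F := by
        by_contra hfin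
        rw [not_infinite_iff_finite] at hfin
        have hDf : Finite D := Module.finite_of_finite F
        have hcomm : ∀ x y : D, x * y = y * x :=
          (Finite.isDomain_to_isField D).mul_comm
        have hfr : Module.finrank F D = 1 := by
          refine (finrank_eq_one_iff_of_nonzero' (1 : D) one_ne_zero).mpr fun w => ?_
          have hw : w ∈ Set.center D := by
            rw [Semigroup.mem_center_iff]
            exact fun g => hcomm g w
          rw [← hcenter] at hw
          obtain ⟨c, hc⟩ := hw
          exact ⟨c, by rw [← hc, Algebra.algebraMap_eq_smul_one]⟩
        rw [hfr] at hn
        nlinarith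
      obtain ⟨x, y, hx, hy, hli⟩ := exists_aux hn2 φ
      refine ⟨x, y, hx, hy, le_antisymm (hup _) ?_⟩
      have hli2 : LinearIndependent F (fun i : Fin n =>
          ((⟨x * y * x⁻¹ * y⁻¹, Algebra.self_mem_adjoin_singleton F _⟩ :
            Algebra.adjoin F {x * y * x⁻¹ * y⁻¹}) ^ (i : ℕ))) := by
        apply LinearIndependent.of_comp (Algebra.adjoin F {x * y * x⁻¹ * y⁻¹}).val.toLinearMap
        exact hli
      simpa using hli2.fintype_card_le_finrank
  · rintro d ⟨x, y, -, -, rfl⟩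
    exact hup _
end

section
/- Let D be a division ring whose center is the field F, with D finite-dimensional over F. Then there exist elements x, y ∈ D such that the subfield F(xy − yx) generated over F by the additive commutator xy − yx is a maximal subfield of D, i.e., it is maximal with respect to inclusion among subfields of D containing F. -/
open scoped TensorProduct

/-- The Krylov matrix of `C` with respect to the first basis vector. -/
def kry {n : ℕ} [NeZero n] {R : Type*} [CommRing R] (C : Matrix (Fin n) (Fin n) R) :
    Matrix (Fin n) (Fin n) R :=
  Matrix.of fun i j => (C ^ (j : ℕ)) i 0

lemma mul_kry {n : ℕ} [NeZero n] {R : Type*} [CommRing R] (M C : Matrix (Fin n) (Fin n) R)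
    (i j : Fin n) : (M * kry C) i j = (M * C ^ (j : ℕ)) i 0 := by
  simp [Matrix.mul_apply, kry]

lemma shift_pow {n : ℕ} [NeZero n] {R : Type*} [CommRing R] (S : Matrix (Fin n) (Fin n) R)
    (hS : ∀ a b, S a b = if (a : ℕ) = b + 1 then 1 else 0) (k : ℕ) (hk : k < n) (i : Fin n) :
    (S ^ k) i 0 = if (i : ℕ) = k then 1 else 0 := by
  induction k generalizing i with
  | zero =>
    rw [pow_zero, Matrix.one_apply]
    simp only [Fin.ext_iff, Fin.val_zero]
  | succ k ih =>
    rw [pow_succ', Matrix.mul_apply, Finset.sum_eq_single (⟨k, by omega⟩ : Fin n)]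
    · rw [ih (by omega), hS]; simp
    · intro b _ hb
      rw [ih (by omega), if_neg (fun h => hb (Fin.ext h)), mul_zero]
    · simp

lemma exists_commutator_kry {n : ℕ} [NeZero n] (E : Type*) [Field E] :
    ∃ X Y : Matrix (Fin n) (Fin n) E, (kry (X * Y - Y * X)).det ≠ 0 := by
  let d : Fin n → E := fun a => if Even (a : ℕ) then 0 else 1
  refine ⟨Matrix.diagonal d,
    Matrix.of fun a b => if (a : ℕ) = b + 1 then d a - d b else 0, ?_⟩
  set S := Matrix.diagonal d * (Matrix.of fun a b : Fin n => if (a : ℕ) = b + 1 then d a - d b else 0) -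
    (Matrix.of fun a b : Fin n => if (a : ℕ) = b + 1 then d a - d b else 0) * Matrix.diagonal d with hSd
  have hS : ∀ a b, S a b = if (a : ℕ) = b + 1 then 1 else 0 := by
    intro a b
    rw [hSd, Matrix.sub_apply, Matrix.diagonal_mul, Matrix.mul_diagonal]
    simp only [Matrix.of_apply]
    split_ifs with h
    · by_cases hb : Even (b : ℕ) <;> simp [d, h, hb, Nat.even_add_one]
    · simp
  have : kry S = 1 := by
    ext i j
    simp only [kry, Matrix.of_apply]
    rw [shift_pow S hS j j.2 i]
    simp [Matrix.one_apply, Fin.ext_iff]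
  rw [this]; simp

lemma map_kry {n : ℕ} [NeZero n] {R S : Type*} [CommRing R] [CommRing S] (f : R →+* S)
    (C : Matrix (Fin n) (Fin n) R) : f (kry C).det = (kry (f.mapMatrix C)).det := by
  rw [RingHom.map_det]
  congr 1
  ext i j
  simp only [kry, RingHom.mapMatrix_apply, Matrix.map_apply, Matrix.of_apply]
  have := map_pow f.mapMatrix C (j : ℕ)
  simp only [RingHom.mapMatrix_apply] at this
  rw [← this]; rfl

lemma exists_points {n : ℕ} [NeZero n] {F E ι : Type*} [Field F] [Infinite F] [Field E]
    [Algebra F E] [Fintype ι] (B : Module.Basis ι E (Matrix (Fin n) (Fin n) E)) :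
    ∃ x y : ι → F,
      (kry ((∑ i, algebraMap F E (x i) • B i) * (∑ i, algebraMap F E (y i) • B i) -
        (∑ i, algebraMap F E (y i) • B i) * (∑ i, algebraMap F E (x i) • B i))).det ≠ 0 := by
  let G : (ι → ι ⊕ ι) → Matrix (Fin n) (Fin n) (MvPolynomial (ι ⊕ ι) E) := fun s =>
    ∑ i, (MvPolynomial.X (s i) : MvPolynomial (ι ⊕ ι) E) • (B i).map MvPolynomial.C
  let P := (kry (G Sum.inl * G Sum.inr - G Sum.inr * G Sum.inl)).det
  have hG : ∀ (z : ι ⊕ ι → E) s, (MvPolynomial.eval z).mapMatrix (G s) = ∑ i, z (s i) • B i := by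
    intro z s
    simp only [G, map_sum]
    refine Finset.sum_congr rfl fun i _ => ?_
    ext a b
    simp
  have hP : ∀ z : ι ⊕ ι → E, MvPolynomial.eval z P =
      (kry ((∑ i, z (.inl i) • B i) * (∑ i, z (.inr i) • B i) -
        (∑ i, z (.inr i) • B i) * (∑ i, z (.inl i) • B i))).det := by
    intro z
    simp only [P]
    rw [map_kry, map_sub, map_mul, map_mul, hG, hG]
  have hP0 : P ≠ 0 := by
    intro h0
    obtain ⟨X, Y, hXY⟩ := exists_commutator_kry (n := n) E
    apply hXY
    have := hP (Sum.elim (B.repr X) (B.repr Y))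
    simpa [h0, B.sum_repr] using this.symm
  by_contra! hcon
  apply hP0
  refine MvPolynomial.funext_set (fun _ => Set.range (algebraMap F E))
    (fun _ => Set.infinite_range_of_injective (algebraMap F E).injective) fun z hz => ?_
  choose w hw using fun i => hz i (Set.mem_univ i)
  rw [hP, map_zero, ← hcon (fun i => w (.inl i)) (fun i => w (.inr i))]
  simp only [hw]

lemma commute_kry {n : ℕ} [NeZero n] {E : Type*} [Field E] (C N : Matrix (Fin n) (Fin n) E)
    (hC : (kry C).det ≠ 0) (h : Commute N C) :
    ∃ a : Fin n → E, N = ∑ j, a j • C ^ (j : ℕ) := by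
  have hu : IsUnit (kry C).det := hC.isUnit
  let v : Fin n → E := fun i => N i 0
  refine ⟨(kry C)⁻¹.mulVec v, ?_⟩
  set a := (kry C)⁻¹.mulVec v with ha
  have hv : (kry C).mulVec a = v := by
    rw [ha, Matrix.mulVec_mulVec, Matrix.mul_nonsing_inv _ hu, Matrix.one_mulVec]
  set N' := ∑ j, a j • C ^ (j : ℕ) with hN'
  have hc' : Commute N' C :=
    Commute.sum_left _ _ _ fun j _ => ((Commute.refl C).pow_left _).smul_left _
  have hM : Commute (N - N') C := h.sub_left hc'
  have h0 : ∀ i, (N - N') i 0 = 0 := by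
    intro i
    have := congrFun hv i
    simp only [Matrix.mulVec, dotProduct, kry, Matrix.of_apply, v] at this
    rw [Matrix.sub_apply, ← this, hN', Matrix.sum_apply, sub_eq_zero]
    exact Finset.sum_congr rfl fun j _ => by simp [mul_comm]
  have hz : (N - N') * kry C = 0 := by
    ext i j
    rw [mul_kry, (hM.pow_right _).eq, Matrix.mul_apply]
    simp [h0]
  rw [← sub_eq_zero]
  calc N - N' = (N - N') * kry C * (kry C)⁻¹ := by
        rw [mul_assoc, Matrix.mul_nonsing_inv _ hu, mul_one]
    _ = 0 := by rw [hz, zero_mul]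

lemma simple_tensor (E F D : Type*) [Field F] [Field E] [Algebra F E] [DivisionRing D]
    [Algebra F D] (hcenter : Set.range (algebraMap F D) = Set.center D) :
    IsSimpleRing (E ⊗[F] D) := by
  classical
  let b := Module.Basis.ofVectorSpace F E
  let L := TensorProduct.equivFinsuppOfBasisLeft (N := D) b
  have hr : ∀ z d i, L (z * (1 ⊗ₜ d)) i = L z i * d := by
    intro z d i
    induction z with
    | zero => simp
    | tmul e c => simp [L]
    | add z w hz hw => rw [add_mul, map_add, map_add, Finsupp.add_apply, Finsupp.add_apply,
        hz, hw, add_mul]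
  have hl : ∀ z d i, L ((1 ⊗ₜ d) * z) i = d * L z i := by
    intro z d i
    induction z with
    | zero => simp
    | tmul e c => simp [L]
    | add z w hz hw => rw [mul_add, map_add, map_add, Finsupp.add_apply, Finsupp.add_apply,
        hz, hw, mul_add]
  refine .of_eq_bot_or_eq_top fun I => ?_
  rw [or_iff_not_imp_left, ← I.one_mem_iff]
  intro H
  have hex : ∃ k, ∃ z ∈ I, z ≠ 0 ∧ (L z).support.card = k := by
    obtain ⟨x, hx1, hx2⟩ := SetLike.exists_of_lt (bot_lt_iff_ne_bot.mpr H : ⊥ < I)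
    exact ⟨_, x, hx1, hx2, rfl⟩
  obtain ⟨z, hzI, hz0, hzk⟩ := Nat.find_spec hex
  have hmin : ∀ w ∈ I, (L w).support.card < (L z).support.card → w = 0 := by
    intro w hw hlt
    by_contra hw0
    exact Nat.find_min hex (hzk ▸ hlt) ⟨w, hw, hw0, rfl⟩
  have hLz : L z ≠ 0 := by simpa using hz0
  obtain ⟨i₀, hi₀⟩ := Finsupp.ne_iff.mp hLz
  rw [Finsupp.zero_apply] at hi₀
  -- normalise
  set u := z * (1 ⊗ₜ (L z i₀)⁻¹) with hu
  have huI : u ∈ I := I.mul_mem_right _ _ hzI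
  have hu1 : L u i₀ = 1 := by rw [hu, hr, mul_inv_cancel₀ hi₀]
  have hus : ∀ j, L z j = 0 → L u j = 0 := by
    intro j hj
    rw [hu, hr, hj, zero_mul]
  clear_value u
  have hcomm : ∀ d i, d * L u i = L u i * d := by
    intro d i
    have hw : (1 ⊗ₜ d) * u - u * (1 ⊗ₜ d) = 0 := by
      apply hmin _ (I.sub_mem (I.mul_mem_left _ _ huI) (I.mul_mem_right _ _ huI))
      apply Finset.card_lt_card
      refine Finset.ssubset_iff_of_subset ?_ |>.mpr ⟨i₀, by simpa using hi₀, ?_⟩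
      · intro j hj
        rw [Finsupp.mem_support_iff] at hj ⊢
        intro hj0
        apply hj
        rw [map_sub, Finsupp.sub_apply, hl, hr, hus j hj0]; simp
      · rw [Finsupp.mem_support_iff, not_not, map_sub, Finsupp.sub_apply, hl, hr, hu1]; simp
    have := congrArg (fun w => L w i) hw
    simpa only [map_sub, Finsupp.sub_apply, hl, hr, map_zero, Finsupp.zero_apply,
      sub_eq_zero] using this
  have hcen : ∀ i, ∃ f : F, algebraMap F D f = L u i := by
    intro i
    have : L u i ∈ Set.center D := by
      rw [Semigroup.mem_center_iff]; exact fun d => hcomm d i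
    rwa [← hcenter] at this
  choose f hf using hcen
  have hue : ∃ e : E, u = e ⊗ₜ 1 := by
    refine ⟨(L u).sum fun i _ => f i • b i, ?_⟩
    have h1 : u = (L u).sum fun i m => b i ⊗ₜ m := by
      conv_lhs => rw [← L.symm_apply_apply u]
      exact TensorProduct.equivFinsuppOfBasisLeft_symm_apply b (L u)
    refine h1.trans ?_
    rw [Finsupp.sum, Finsupp.sum, TensorProduct.sum_tmul]
    refine Finset.sum_congr rfl fun i _ => ?_
    rw [← hf i, TensorProduct.smul_tmul, Algebra.algebraMap_eq_smul_one]
  obtain ⟨e, he⟩ := hue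
  have he0 : e ≠ 0 := by
    rintro rfl
    rw [he] at hu1
    simp at hu1
  have := I.mul_mem_left (e⁻¹ ⊗ₜ 1) _ huI
  rw [he, Algebra.TensorProduct.tmul_mul_tmul, inv_mul_cancel₀ he0, one_mul] at this
  exact this

theorem maximal_subfield_of_additive_commutator
    (F D : Type*) [Field F] [DivisionRing D] [Algebra F D]
    (hcenter : Set.range (algebraMap F D) = Set.center D)
    [FiniteDimensional F D] :
    ∃ x y : D,
      Maximal (fun K : Subfield D => Set.range (algebraMap F D) ⊆ (K : Set D) ∧
          ∀ a ∈ K, ∀ b ∈ K, a * b = b * a)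
        (Subfield.closure (Set.range (algebraMap F D) ∪ {x * y - y * x})) := by
  -- It suffices that the centralizer of the commutator is inside the closure.
  suffices h : ∃ x y : D, ∀ d : D, Commute d (x * y - y * x) →
      d ∈ Subfield.closure (Set.range (algebraMap F D) ∪ {x * y - y * x}) by
    obtain ⟨x, y, h⟩ := h
    refine ⟨x, y, ⟨fun a ha => Subfield.subset_closure (Or.inl ha), ?_⟩, ?_⟩
    · set c := x * y - y * x
      have hgen : ∀ d : D, Commute d c → ∀ a ∈ Subfield.closure (Set.range (algebraMap F D) ∪ {c}),
          Commute a d := by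
        intro d hd a ha
        induction ha using Subfield.closure_induction with
        | mem a ha =>
          rcases ha with ⟨r, rfl⟩ | rfl
          · exact Algebra.commutes r d
          · exact hd.symm
        | one => exact Commute.one_left _
        | add a b _ _ ha hb => exact ha.add_left hb
        | neg a _ ha => exact ha.neg_left
        | inv a _ ha => exact ha.inv_left₀
        | mul a b _ _ ha hb => exact ha.mul_left hb
      intro a ha b hb
      exact hgen b (hgen c (Commute.refl c) b hb) a ha
    · rintro K ⟨-, hK⟩ hle d hd
      exact h d (hK d hd _ (hle (Subfield.subset_closure (Or.inr rfl))))
  rcases finite_or_infinite F with hF | hF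
  · have : Finite D := Module.finite_of_finite F
    let := littleWedderburn D
    refine ⟨0, 0, fun d _ => Subfield.subset_closure (Or.inl ?_)⟩
    rw [hcenter, Semigroup.mem_center_iff]
    intro g
    exact mul_comm g d
  let E := AlgebraicClosure F
  have := simple_tensor E F D hcenter
  obtain ⟨n, hn, ⟨e⟩⟩ := IsSimpleRing.exists_algEquiv_matrix_of_isAlgClosed E (E ⊗[F] D)
  let b := Module.finBasis F D
  let B := (Algebra.TensorProduct.basis E b).map e.toLinearEquiv
  obtain ⟨p, q, hpq⟩ := exists_points (F := F) B
  let φ : D →ₐ[F] Matrix (Fin n) (Fin n) E :=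
    (e.restrictScalars F).toAlgHom.comp Algebra.TensorProduct.includeRight
  have hφ : ∀ d, φ d = e (1 ⊗ₜ d) := fun d => rfl
  have hφs : ∀ p : Fin (Module.finrank F D) → F,
      φ (∑ i, p i • b i) = ∑ i, algebraMap F E (p i) • B i := by
    intro p
    rw [map_sum]
    refine Finset.sum_congr rfl fun i _ => ?_
    rw [map_smul, algebraMap_smul, hφ]
    simp [B]
  refine ⟨∑ i, p i • b i, ∑ i, q i • b i, fun d hd => ?_⟩
  rw [← hφs, ← hφs, ← map_mul, ← map_mul, ← map_sub] at hpq
  set c := (∑ i, p i • b i) * (∑ i, q i • b i) - (∑ i, q i • b i) * (∑ i, p i • b i)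
  obtain ⟨a, ha⟩ := commute_kry (φ c) (φ d) hpq (hd.map φ)
  have hmem : d ∈ Submodule.span F (Set.range fun j : ℕ => c ^ j) := by
    by_contra hnot
    obtain ⟨f, hfd, hf⟩ := Submodule.exists_le_ker_of_notMem hnot
    have hd' : (1 : E) ⊗ₜ[F] d = ∑ j, a j • ((1 : E) ⊗ₜ[F] (c ^ (j : ℕ))) := by
      apply e.injective
      rw [← hφ, ha, map_sum]
      refine Finset.sum_congr rfl fun j _ => ?_
      rw [map_smul, ← hφ, map_pow]
    have h2 := congrArg (f.baseChange E) hd'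
    have hz : ∀ j : ℕ, f (c ^ j) = 0 := fun j => hf (Submodule.subset_span ⟨j, rfl⟩)
    rw [map_sum] at h2
    simp only [map_smul, LinearMap.baseChange_tmul, hz, TensorProduct.tmul_zero, smul_zero,
      Finset.sum_const_zero] at h2
    have h3 := congrArg (TensorProduct.rid F E) h2
    simp at h3
    exact hfd h3
  have key : ∀ w ∈ Submodule.span F (Set.range fun j : ℕ => c ^ j),
      w ∈ Subfield.closure (Set.range (algebraMap F D) ∪ {c}) := by
    intro w hw
    induction hw using Submodule.span_induction with
    | mem x hx =>
      obtain ⟨j, rfl⟩ := hx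
      have hc : c ∈ Subfield.closure (Set.range (algebraMap F D) ∪ {c}) :=
        Subfield.subset_closure (Or.inr rfl)
      exact pow_mem hc j
    | zero => exact zero_mem _
    | add x y _ _ hx hy => exact add_mem hx hy
    | smul r x _ hx =>
      rw [Algebra.smul_def]
      exact mul_mem (Subfield.subset_closure (Or.inl ⟨r, rfl⟩)) hx
  exact key d hmem
end

section
/- Let D be a division ring whose center is the field F, with dim_F D = n² finite (so D has degree n over F). Then there exist elements x, y ∈ D such that the subfield F(xy − yx) satisfies dim_F F(xy − yx) = n; that is, the maximum over all x, y ∈ D of dim_F F(xy − yx) equals n. -/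
section

open TensorProduct

theorem aux_split (F L D : Type*) [Field F] [Field L] [IsAlgClosed L] [Algebra F L]
    [DivisionRing D] [Algebra F D] [FiniteDimensional F D]
    (hcenter : Set.range (algebraMap F D) = Set.center D)
    (n : ℕ) (hn : Module.finrank F D = n ^ 2) :
    Nonempty ((L ⊗[F] D) ≃ₐ[L] Matrix (Fin n) (Fin n) L) := by
  have := aux_simple F L D hcenter
  obtain ⟨m, _, ⟨e⟩⟩ := IsSimpleRing.exists_algEquiv_matrix_of_isAlgClosed L (L ⊗[F] D)
  have h := e.toLinearEquiv.finrank_eq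
  rw [Module.finrank_baseChange, hn, Module.finrank_matrix] at h
  simp only [Fintype.card_fin, Module.finrank_self, mul_one, ← sq] at h
  have : n = m := Nat.pow_left_injective two_ne_zero h
  subst this
  exact ⟨e⟩

theorem aux_upper (F L D : Type*) [Field F] [Field L] [Algebra F L]
    [DivisionRing D] [Algebra F D] [FiniteDimensional F D] (n : ℕ)
    (e : (L ⊗[F] D) ≃ₐ[L] Matrix (Fin n) (Fin n) L) (c : D) :
    (minpoly F c).natDegree ≤ n := by
  by_contra! hlt
  have h1 := linearIndependent_pow (K := F) c
  have h2 := ((Module.Basis.sumExtend h1).baseChange L).linearIndependent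
  have h3 := h2.comp (Sum.inl ∘ Fin.castLE (n := n+1) hlt)
    (Sum.inl_injective.comp (Fin.castLE_injective _))
  have h4 : ((Module.Basis.sumExtend h1).baseChange L) ∘ (Sum.inl ∘ Fin.castLE (n := n+1) hlt)
      = fun i : Fin (n+1) => ((1 : L) ⊗ₜ[F] c) ^ (i : ℕ) := by
    funext i
    simp [Module.Basis.sumExtend]
    rfl
  rw [h4, Fintype.linearIndependent_iff] at h3
  set p := (e (1 ⊗ₜ[F] c)).charpoly
  have hp : p.natDegree = n := by simp [p]
  have h5 : Polynomial.aeval ((1 : L) ⊗ₜ[F] c) p = 0 := by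
    apply e.injective
    rw [map_zero, ← Polynomial.aeval_algHom_apply]
    exact Matrix.aeval_self_charpoly _
  rw [Polynomial.aeval_eq_sum_range, hp, ← Fin.sum_univ_eq_sum_range
    (fun i => p.coeff i • ((1 : L) ⊗ₜ[F] c) ^ i)] at h5
  have h6 := h3 (fun i => p.coeff i) h5 (Fin.last n)
  have h7 : p.Monic := Matrix.charpoly_monic _
  rw [Polynomial.Monic, Polynomial.leadingCoeff, hp] at h7
  simp [h7] at h6

theorem aux_finrank (F D : Type*) [Field F] [DivisionRing D] [Algebra F D]
    [FiniteDimensional F D] (c : D) :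
    Module.finrank F (Algebra.adjoin F {c} : Subalgebra F D) = (minpoly F c).natDegree := by
  classical
  have hc : IsIntegral F c := IsIntegral.of_finite F c
  have h := Submodule.span_range_natDegree_eq_adjoin (minpoly.monic hc) (minpoly.aeval F c)
  have h2 := finrank_span_eq_card (linearIndependent_pow (K := F) c)
  rw [Fintype.card_fin] at h2
  rw [← h2]
  change Module.finrank F (Subalgebra.toSubmodule (Algebra.adjoin F {c})) = _
  have h3 : ((Finset.image (c ^ ·) (Finset.range (minpoly F c).natDegree) : Finset D) : Set D) =
      Set.range fun i : Fin (minpoly F c).natDegree => c ^ (i : ℕ) := by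
    ext y
    simp [Fin.exists_iff]
  rw [← h, h3]

theorem aux_mat (L : Type*) [Field L] (n : ℕ) : ∃ x y : Matrix (Fin n) (Fin n) L,
    LinearIndependent L fun i : Fin n => (x * y - y * x) ^ (i : ℕ) := by
  let N : Matrix (Fin n) (Fin n) L := Matrix.of fun i j => if (i : ℕ) + 1 = j then 1 else 0
  let x : Matrix (Fin n) (Fin n) L := Matrix.diagonal fun i => -((i : ℕ) : L)
  have hc : x * N - N * x = N := by
    ext i j
    simp only [x, N, Matrix.sub_apply, Matrix.diagonal_mul, Matrix.mul_diagonal, Matrix.of_apply]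
    split_ifs with h
    · rw [← h]; push_cast; ring
    · simp
  have hpow : ∀ k : ℕ, N ^ k = Matrix.of fun i j : Fin n => if (i : ℕ) + k = j then 1 else 0 := by
    intro k
    induction k with
    | zero => ext i j; simp [Matrix.one_apply, Fin.ext_iff]
    | succ k ih =>
      ext i j
      rw [pow_succ, ih, Matrix.mul_apply]
      simp only [N, Matrix.of_apply, ite_mul, one_mul, zero_mul]
      by_cases h : (i : ℕ) + (k + 1) = j
      · rw [if_pos h, Finset.sum_eq_single ⟨i + k, by have := j.2; omega⟩]
        · simp; omega
        · intro b _ hb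
          rw [if_neg]
          intro h'; apply hb; ext; exact h'.symm
        · simp
      · rw [if_neg h]
        refine Finset.sum_eq_zero fun b _ => ?_
        split_ifs <;> first | rfl | omega
  refine ⟨x, N, ?_⟩
  rw [hc, Fintype.linearIndependent_iff]
  intro g hg i
  have hn : 0 < n := i.pos
  have := congrFun (congrFun hg ⟨0, hn⟩) i
  simpa [hpow, Matrix.sum_apply, ← Fin.ext_iff] using this

/-- coordinates commute with specialisation -/
theorem aux_coord {F P S D ι : Type*} [Field F] [CommRing P] [CommRing S] [Algebra F P]
    [Algebra F S] [Ring D] [Algebra F D] (b : Module.Basis ι F D) (φ : P →ₐ[F] S)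
    (z : P ⊗[F] D) (i : ι) :
    (b.baseChange S).repr (Algebra.TensorProduct.map φ (AlgHom.id F D) z) i =
      φ ((b.baseChange P).repr z i) := by
  induction z using TensorProduct.induction_on with
  | zero => simp
  | tmul x y => simp
  | add x y hx hy => simp [hx, hy]

theorem aux_lower (F L D : Type*) [Field F] [Infinite F] [Field L] [Algebra F L]
    [DivisionRing D] [Algebra F D] [FiniteDimensional F D] (n : ℕ)
    (e : (L ⊗[F] D) ≃ₐ[L] Matrix (Fin n) (Fin n) L) :
    ∃ x y : D, LinearIndependent F fun i : Fin n => (x * y - y * x) ^ (i : ℕ) := by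
  classical
  let b := Module.finBasis F D
  let d := Module.finrank F D
  let V := (Fin d ⊕ Fin d) ⊕ (Fin d × Fin n)
  let P := MvPolynomial V F
  let gx : P ⊗[F] D := ∑ i, (MvPolynomial.X (Sum.inl (Sum.inl i)) : P) ⊗ₜ[F] b i
  let gy : P ⊗[F] D := ∑ i, (MvPolynomial.X (Sum.inl (Sum.inr i)) : P) ⊗ₜ[F] b i
  let M : Matrix (Fin n) (Fin d) P :=
    Matrix.of fun k i => (b.baseChange P).repr ((gx * gy - gy * gx) ^ (k : ℕ)) i
  let Y : Matrix (Fin d) (Fin n) P := Matrix.of fun i k => MvPolynomial.X (Sum.inr (i, k))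
  -- the polynomial is nonzero, by specialising to `L`
  have hq : (M * Y).det ≠ 0 := by
    intro h0
    obtain ⟨x0, y0, hxy⟩ := aux_mat L n
    let x := e.symm x0
    let y := e.symm y0
    have hli : LinearIndependent L fun i : Fin n => (x * y - y * x) ^ (i : ℕ) := by
      have := hxy.map' e.symm.toLinearMap (LinearMap.ker_eq_bot.2 e.symm.injective)
      have h : (e.symm.toLinearMap ∘ fun i : Fin n => (x0 * y0 - y0 * x0) ^ (i : ℕ)) =
          fun i : Fin n => (x * y - y * x) ^ (i : ℕ) := by
        funext i
        simp [x, y]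
      rw [h] at this
      exact this
    have hinj : Function.Injective
        (Fintype.linearCombination L fun i : Fin n => (x * y - y * x) ^ (i : ℕ)) :=
      hli.fintypeLinearCombination_injective
    obtain ⟨g, hg⟩ := LinearMap.exists_leftInverse_of_injective _ (LinearMap.ker_eq_bot.2 hinj)
    let φ : P →ₐ[F] L := MvPolynomial.aeval (Sum.elim
      (Sum.elim (fun i => (b.baseChange L).repr x i) (fun i => (b.baseChange L).repr y i))
      (fun p => g ((b.baseChange L) p.1) p.2))
    have hφ1 : ∀ i, φ (MvPolynomial.X (Sum.inl (Sum.inl i))) = (b.baseChange L).repr x i :=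
      fun i => MvPolynomial.aeval_X _ _
    have hφ2 : ∀ i, φ (MvPolynomial.X (Sum.inl (Sum.inr i))) = (b.baseChange L).repr y i :=
      fun i => MvPolynomial.aeval_X _ _
    have hφ3 : ∀ i k, φ (MvPolynomial.X (Sum.inr (i, k))) = g ((b.baseChange L) i) k :=
      fun i k => MvPolynomial.aeval_X _ _
    let Φ := Algebra.TensorProduct.map φ (AlgHom.id F D)
    have hsum : ∀ z : L ⊗[F] D, ∑ i, ((b.baseChange L).repr z i) ⊗ₜ[F] b i = z := by
      intro z
      conv_rhs => rw [← (b.baseChange L).sum_repr z]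
      simp [TensorProduct.smul_tmul']
    have hx : Φ gx = x := by
      conv_rhs => rw [← hsum x]
      simp [Φ, gx, hφ1]
      rfl
    have hy : Φ gy = y := by
      conv_rhs => rw [← hsum y]
      simp [Φ, gy, hφ2]
      rfl
    have h1 : (M * Y).map φ = 1 := by
      ext k l
      have h2 := congrFun (LinearMap.congr_fun hg (Pi.single k 1)) l
      rw [LinearMap.comp_apply, Fintype.linearCombination_apply_single, one_smul] at h2
      rw [← (b.baseChange L).sum_repr ((x * y - y * x) ^ (k : ℕ))] at h2
      simp only [map_sum, map_smul, Finset.sum_apply, Pi.smul_apply, smul_eq_mul] at h2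
      simp only [Matrix.map_apply, Matrix.mul_apply, map_sum, map_mul]
      rw [Matrix.one_apply]
      simp only [LinearMap.id_apply, Pi.single_apply] at h2
      simp only [eq_comm (a := k)]
      rw [← h2]
      refine Finset.sum_congr rfl fun i _ => ?_
      congr 1
      · simp only [M, Matrix.of_apply]
        rw [← aux_coord]
        change (b.baseChange L).repr (Φ _) i = _
        simp [hx, hy]
      · simp only [Y, Matrix.of_apply, hφ3]
    have h2 := congrArg φ h0
    rw [AlgHom.map_det, AlgHom.mapMatrix_apply, h1] at h2
    simp at h2
  obtain ⟨v, hv⟩ : ∃ v : V → F, MvPolynomial.eval v (M * Y).det ≠ 0 := by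
    by_contra! h
    exact hq (MvPolynomial.funext fun v => by simp [h v])
  let φ : P →ₐ[F] F := MvPolynomial.aeval v
  let Φ : P ⊗[F] D →ₐ[F] F ⊗[F] D := Algebra.TensorProduct.map φ (AlgHom.id F D)
  let Ψ := Algebra.TensorProduct.lid F D
  refine ⟨Ψ (Φ gx), Ψ (Φ gy), ?_⟩
  have hdet : ((M * Y).map φ).det ≠ 0 := by
    rw [← AlgHom.mapMatrix_apply, ← AlgHom.map_det]
    have h : φ (M * Y).det = MvPolynomial.eval v (M * Y).det := by
      change MvPolynomial.aeval v _ = _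
      rw [MvPolynomial.aeval_eq_eval]
    rw [h]
    exact hv
  rw [Fintype.linearIndependent_iff]
  intro g hg
  have hg' : ∑ i : Fin n, g i • Φ ((gx * gy - gy * gx) ^ (i : ℕ)) = 0 := by
    apply Ψ.injective
    simpa using hg
  have h3 : Matrix.vecMul g (M.map φ) = 0 := by
    funext i
    have := congrArg (fun z => (b.baseChange F).repr z i) hg'
    simp only [map_sum, map_smul, Finsupp.coe_finsetSum, Finset.sum_apply, Finsupp.smul_apply,
      map_zero, Finsupp.coe_zero, Pi.zero_apply, Φ, aux_coord] at this
    simpa [Matrix.vecMul, dotProduct, M] using this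
  have h4 : Matrix.vecMul g ((M * Y).map φ) = 0 := by
    have : (M * Y).map φ = M.map φ * Y.map φ := Matrix.map_mul
    rw [this, ← Matrix.vecMul_vecMul, h3, Matrix.zero_vecMul]
  have h5 := Matrix.eq_zero_of_vecMul_eq_zero hdet h4
  exact fun i => congrFun h5 i

end

/-- **Theorem.** Let `D` be a division ring whose center is the field `F`, with
`dim_F D = n ^ 2` finite (so `D` has degree `n` over `F`). Then the maximum, over all
`x y : D`, of `dim_F F(x * y - y * x)` equals `n`; here `F(x * y - y * x)` is the
`F`-subalgebra of `D` generated by the additive commutator `x * y - y * x` (a subfield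
of `D`, since the commutator is algebraic over `F`). -/
theorem finrank_adjoin_additive_commutator_isGreatest
    (F D : Type*) [Field F] [DivisionRing D] [Algebra F D]
    (hcenter : Set.range (algebraMap F D) = Set.center D)
    [FiniteDimensional F D] (n : ℕ) (hn : Module.finrank F D = n ^ 2) :
    IsGreatest {d : ℕ | ∃ x y : D,
      Module.finrank F (Algebra.adjoin F {x * y - y * x} : Subalgebra F D) = d} n := by
  obtain ⟨e⟩ := aux_split F (AlgebraicClosure F) D hcenter n hn
  have hup : ∀ c : D, Module.finrank F (Algebra.adjoin F {c} : Subalgebra F D) ≤ n := by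
    intro c
    rw [aux_finrank]
    exact aux_upper F (AlgebraicClosure F) D n e c
  refine ⟨?_, ?_⟩
  · rcases finite_or_infinite F with hF | hF
    · -- finite case: `D` is commutative by Wedderburn
      have : Finite D := Module.finite_of_finite F
      have hsurj : Function.Surjective (algebraMap F D) := by
        intro a
        have : a ∈ Set.center D := by
          rw [Semigroup.mem_center_iff]
          let := littleWedderburn D
          exact fun g => mul_comm (G := D) g a
        rw [← hcenter] at this
        exact this
      have hb : Module.finrank F D = 1 := by
        have := (LinearEquiv.ofBijective (Algebra.linearMap F D)
          ⟨(algebraMap F D).injective, hsurj⟩).finrank_eq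
        simpa using this.symm
      have hn1 : n = 1 := by
        rw [hn] at hb
        simpa using hb
      refine ⟨0, 0, le_antisymm (hup _) ?_⟩
      rw [hn1]
      exact Module.finrank_pos
    · obtain ⟨x, y, hxy⟩ := aux_lower F (AlgebraicClosure F) D n e
      refine ⟨x, y, le_antisymm (hup _) ?_⟩
      have h := finrank_span_eq_card hxy
      rw [Fintype.card_fin] at h
      conv_lhs => rw [← h]
      change _ ≤ Module.finrank F (Subalgebra.toSubmodule (Algebra.adjoin F {x * y - y * x}))
      apply Submodule.finrank_mono
      rw [Submodule.span_le]
      rintro _ ⟨i, rfl⟩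
      exact pow_mem (Algebra.self_mem_adjoin_singleton F _) _
  · rintro _ ⟨x, y, rfl⟩
    exact hup _
end

section
/- Let F be a field, let A be a finite-dimensional central simple algebra over F, let n be a positive integer, and let a ∈ A. Then the following are equivalent: (1) a is algebraic over F of degree at most n (i.e., the minimal polynomial of a over F has degree at most n); (2) g_n(a, r_1, r_2, …, r_n) = 0 for all r_1, r_2, …, r_n ∈ A. -/
/-- The generalized polynomial
`g_n(a, r_1, …, r_n) = Σ_{δ ∈ S_{n+1}} sign(δ) · a^{δ 0} * r_1 * a^{δ 1} * ⋯ * r_n * a^{δ n}`,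
where the sum runs over all permutations `δ` of `{0, 1, …, n}`. -/
def gExpr {R : Type*} [Ring R] (n : ℕ) (a : R) (r : Fin n → R) : R :=
  ∑ δ : Equiv.Perm (Fin (n + 1)),
    (Equiv.Perm.sign δ : ℤ) •
      (a ^ ((δ 0 : Fin (n + 1)) : ℕ) *
        (List.ofFn fun i : Fin n => r i * a ^ ((δ i.succ : Fin (n + 1)) : ℕ)).prod)

theorem gen_key {F A : Type*} [Field F] [Ring A] [Algebra F A]
    [IsSimpleRing A] (hcenter : Subalgebra.center F A = ⊥) :
    ∀ (m : ℕ) (b c : Fin m → A), LinearIndependent F b →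
      (∀ r : A, ∑ i, b i * r * c i = 0) → ∀ i, c i = 0 := by
  intro m
  induction m with
  | zero => intro b c _ _ i; exact i.elim0
  | succ m ih =>
    intro b c hb h
    have hb' : LinearIndependent F (fun i : Fin m => b i.succ) :=
      hb.comp _ (Fin.succ_injective m)
    have h0 : c 0 = 0 := by
      by_contra hc
      let J : TwoSidedIdeal A := TwoSidedIdeal.mk'
        {x | ∃ d : Fin m → A, ∀ r, b 0 * r * x + ∑ i : Fin m, b i.succ * r * d i = 0}
        ⟨0, by simp⟩
        (by
          rintro x y ⟨d, hd⟩ ⟨e, he⟩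
          refine ⟨d + e, fun r => ?_⟩
          have := congrArg₂ (· + ·) (hd r) (he r)
          simp only [add_zero] at this
          rw [← this]
          simp only [Pi.add_apply, mul_add, Finset.sum_add_distrib]
          abel)
        (by
          rintro x ⟨d, hd⟩
          refine ⟨-d, fun r => ?_⟩
          have := congrArg (- ·) (hd r)
          simp only [neg_zero] at this
          rw [← this]
          simp only [Pi.neg_apply, mul_neg, Finset.sum_neg_distrib]
          abel)
        (by
          rintro x y ⟨d, hd⟩
          refine ⟨fun i => x * d i, fun r => ?_⟩
          simpa [mul_assoc] using hd (r * x))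
        (by
          rintro x y ⟨d, hd⟩
          refine ⟨fun i => d i * y, fun r => ?_⟩
          have := congrArg (· * y) (hd r)
          simpa [add_mul, Finset.sum_mul, mul_assoc] using this)
      have hmem : ∀ x, x ∈ J ↔
          ∃ d : Fin m → A, ∀ r, b 0 * r * x + ∑ i : Fin m, b i.succ * r * d i = 0 := by
        intro x
        exact TwoSidedIdeal.mem_mk' ..
      have hcJ : c 0 ∈ J := (hmem _).2 ⟨fun i => c i.succ, fun r => by
        simpa [Fin.sum_univ_succ] using h r⟩
      have h1 : (1 : A) ∈ J := by
        rcases eq_bot_or_eq_top J with hJ | hJ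
        · rw [hJ] at hcJ
          exact absurd ((TwoSidedIdeal.mem_bot A).1 hcJ) hc
        · rw [hJ]; trivial
      obtain ⟨d, hd⟩ := (hmem 1).1 h1
      have hcen : ∀ i, ∃ l : F, algebraMap F A l = d i := by
        intro i
        have : d i ∈ Subalgebra.center F A := by
          rw [Subalgebra.mem_center_iff]
          intro s
          have := ih (fun i => b i.succ) (fun i => s * d i - d i * s) hb' (fun r => by
            have e1 := hd (r * s)
            have e2 := congrArg (· * s) (hd r)
            simp only [add_mul, Finset.sum_mul, zero_mul, mul_one, mul_assoc] at e1 e2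
            simp only [mul_sub, Finset.sum_sub_distrib, mul_assoc]
            rw [sub_eq_zero]
            exact add_left_cancel (e1.trans e2.symm)) i
          exact sub_eq_zero.1 this
        rw [hcenter, Algebra.mem_bot] at this
        exact this
      choose l hl using hcen
      have := Fintype.linearIndependent_iff.1 hb (Fin.cons 1 l) (by
        have := hd 1
        simp only [mul_one, ← hl] at this
        simpa [Fin.sum_univ_succ, Algebra.smul_def, ← Algebra.commutes] using this) 0
      simp at this
    intro i
    refine Fin.cases h0 (ih (fun i => b i.succ) (fun i => c i.succ) hb' ?_) i
    intro r
    simpa [Fin.sum_univ_succ, h0] using h r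

/-- The multilinear map `v ↦ v 0 * r 0 * v 1 * ⋯`. -/
noncomputable def genMul (F : Type*) {A : Type*} [Field F] [Ring A] [Algebra F A] (n : ℕ)
    (r : Fin n → A) : MultilinearMap F (fun _ : Fin (n + 1) => A) A :=
  (MultilinearMap.mkPiAlgebraFin F (n + 1) A).compLinearMap
    (Fin.cons LinearMap.id (fun i => LinearMap.mulLeft F (r i)))

theorem genMul_apply (F : Type*) {A : Type*} [Field F] [Ring A] [Algebra F A] (n : ℕ)
    (r : Fin n → A) (v : Fin (n + 1) → A) :
    genMul F n r v = v 0 * (List.ofFn fun i : Fin n => r i * v i.succ).prod := by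
  simp [genMul, List.ofFn_succ]

theorem genMul_succ (F : Type*) {A : Type*} [Field F] [Ring A] [Algebra F A] (n : ℕ)
    (r : Fin (n + 1) → A) (v : Fin (n + 2) → A) :
    genMul F (n + 1) r v = v 0 * r 0 * genMul F n (fun i => r i.succ) (fun i => v i.succ) := by
  simp [genMul_apply, List.ofFn_succ, mul_assoc]

theorem gen_alt_succ (F : Type*) {A : Type*} [Field F] [Ring A] [Algebra F A] (n : ℕ)
    (r : Fin (n + 1) → A) (v : Fin (n + 2) → A) :
    (genMul F (n + 1) r).alternatization v = ∑ p : Fin (n + 2), v p * r 0 *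
      ((if p = 0 then (1 : ℤ) else -1) • (genMul F n (fun i => r i.succ)).alternatization
        (fun i => v (Equiv.swap 0 p i.succ))) := by
  simp only [MultilinearMap.alternatization_apply, MultilinearMap.domDomCongr_apply]
  rw [← Equiv.Perm.decomposeFin.symm.sum_comp, Fintype.sum_prod_type]
  refine Finset.sum_congr rfl fun p _ => ?_
  rw [Finset.smul_sum, Finset.mul_sum]
  refine Finset.sum_congr rfl fun e _ => ?_
  rw [genMul_succ]
  simp only [Equiv.Perm.decomposeFin_symm_apply_zero, Equiv.Perm.decomposeFin_symm_apply_succ,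
    Equiv.Perm.decomposeFin.symm_sign, Units.smul_def]
  split_ifs <;> simp [-zsmul_eq_mul, mul_smul_comm]

theorem gen_ne {F A : Type*} [Field F] [Ring A] [Algebra F A]
    [IsSimpleRing A] (hcenter : Subalgebra.center F A = ⊥) (n : ℕ) :
    ∀ v : Fin (n + 1) → A, LinearIndependent F v →
      ¬ ∀ r : Fin n → A, (genMul F n r).alternatization v = 0 := by
  induction n with
  | zero =>
    intro v hv h
    have := h Fin.elim0
    rw [MultilinearMap.alternatization_apply] at this
    simp [genMul_apply] at this
    exact hv.ne_zero 0 this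
  | succ n ih =>
    intro v hv h
    refine ih (fun i => v (Equiv.swap 0 0 i.succ))
      (hv.comp _ ((Equiv.injective _).comp (Fin.succ_injective _))) fun r => ?_
    have := gen_key hcenter _ v _ hv (fun x => by
      have := h (Fin.cons x r)
      rw [gen_alt_succ] at this
      simpa only [Fin.cons_zero, Fin.cons_succ] using this) 0
    simpa using this

theorem gExpr_eq_alt (F : Type*) {A : Type*} [Field F] [Ring A] [Algebra F A] (n : ℕ) (a : A)
    (r : Fin n → A) :
    gExpr n a r = (genMul F n r).alternatization (fun i => a ^ (i : ℕ)) := by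
  simp only [gExpr, MultilinearMap.alternatization_apply, MultilinearMap.domDomCongr_apply,
    genMul_apply, Units.smul_def]

/-- **Lemma (Bien, Lemma 2.2).** Let `A` be a finite-dimensional central simple algebra
over a field `F` (so `A` is a simple ring whose center is exactly `F`), `n` a positive
integer and `a ∈ A`. Then `a` is algebraic of degree at most `n` over `F` (i.e. its
minimal polynomial over `F` has degree at most `n`) if and only if
`g_n(a, r_1, …, r_n) = 0` for all `r_1, …, r_n ∈ A`. -/
theorem minpoly_natDegree_le_iff_gExpr_eq_zero
    (F A : Type*) [Field F] [Ring A] [Algebra F A] [FiniteDimensional F A]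
    [IsSimpleRing A] (hcenter : Subalgebra.center F A = ⊥)
    (n : ℕ) (hn : 0 < n) (a : A) :
    (minpoly F a).natDegree ≤ n ↔ ∀ r : Fin n → A, gExpr n a r = 0 := by
  simp only [gExpr_eq_alt F]
  have hint : IsIntegral F a := Algebra.IsIntegral.isIntegral a
  constructor
  · intro h r
    apply AlternatingMap.map_linearDependent
    intro hli
    have hp := minpoly.aeval F a
    rw [Polynomial.aeval_eq_sum_range' (Nat.lt_succ_of_le h), Finset.sum_range] at hp
    have h2 := Fintype.linearIndependent_iff.1 hli _ hp
      ⟨(minpoly F a).natDegree, Nat.lt_succ_of_le h⟩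
    exact minpoly.ne_zero hint (Polynomial.leadingCoeff_eq_zero.1 h2)
  · intro h
    by_contra hlt
    push Not at hlt
    refine gen_ne hcenter n _ ?_ h
    exact (linearIndependent_pow (K := F) a).comp
      (fun i : Fin (n + 1) => (⟨i, by omega⟩ : Fin (minpoly F a).natDegree))
      (fun i j hij => Fin.ext (by simpa using hij))
end
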